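/- arXiv:1409.5383 — 3 statements merged into one kernel-verified Lean document; each statement's English description precedes it below -/
import Mathlib

section
/- If α ≤ n−1, then the price of stability of the SUM-game is 1: there exists a Nash equilibrium S such that c(S) ≤ c(S') for every nonempty S' ⊆ V. -/
open Finset

/-- Distance from a node `u` to the gateway set `S` (hop distance to nearest gateway). -/
noncomputable def gwDist {V : Type*} (G : SimpleGraph V) (S : Finset V) (u : V) : ℕ :=
  sInf ((fun s => G.dist u s) '' (S : Set V))

/-- Communication distance `δ_S(u,v) = min{d(u,v), d(u,S) + d(S,v)}`. -/
noncomputable def comDist {V : Type*} (G : SimpleGraph V) (S : Finset V) (u v : V) : ℕ :=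
  min (G.dist u v) (gwDist G S u + gwDist G S v)

/-- Private cost of node `v` in the SUM-game. -/
noncomputable def sumCost {V : Type*} [Fintype V] [DecidableEq V]
    (G : SimpleGraph V) (α : ℝ) (S : Finset V) (v : V) : ℝ :=
  (if v ∈ S then α else 0) + ∑ u : V, (comDist G S v u : ℝ)

/-- Social cost of the SUM-game. -/
noncomputable def sumSocial {V : Type*} [Fintype V] [DecidableEq V]
    (G : SimpleGraph V) (α : ℝ) (S : Finset V) : ℝ :=
  ∑ v : V, sumCost G α S v

/-- `v` performs an improving response changing profile `S` into `S'` in the SUM-game. -/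
def SumIRBy {V : Type*} [Fintype V] [DecidableEq V]
    (G : SimpleGraph V) (α : ℝ) (v : V) (S S' : Finset V) : Prop :=
  ((v ∉ S ∧ S' = insert v S) ∨ (v ∈ S ∧ S' = S.erase v ∧ (S.erase v).Nonempty)) ∧
    sumCost G α S' v < sumCost G α S v

/-- `S'` arises from `S` by an improving response in the SUM-game. -/
def SumIR {V : Type*} [Fintype V] [DecidableEq V]
    (G : SimpleGraph V) (α : ℝ) (S S' : Finset V) : Prop :=
  ∃ v, SumIRBy G α v S S'

/-- `S` is a Nash equilibrium of the SUM-game: no node has an improving response. -/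
def SumNash {V : Type*} [Fintype V] [DecidableEq V]
    (G : SimpleGraph V) (α : ℝ) (S : Finset V) : Prop :=
  ∀ S', ¬ SumIR G α S S'

/-- A node that is not a gateway has positive distance to a nonempty gateway set. -/
theorem one_le_gwDist {V : Type*} {G : SimpleGraph V} (hG : G.Connected) {S : Finset V}
    (hS : S.Nonempty) {v : V} (hv : v ∉ S) : 1 ≤ gwDist G S v := by
  have hne : ((fun s => G.dist v s) '' (S : Set V)).Nonempty := by
    simpa using hS
  obtain ⟨s, hs, hsv⟩ := Nat.sInf_mem hne
  rw [gwDist, ← hsv]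
  exact hG.pos_dist_of_ne fun h => hv (h ▸ hs)

/-- A gateway has distance zero to the gateway set. -/
theorem gwDist_eq_zero {V : Type*} (G : SimpleGraph V) {S : Finset V} {v : V} (hv : v ∈ S) :
    gwDist G S v = 0 :=
  Nat.sInf_eq_zero.2 (Or.inl ⟨v, hv, SimpleGraph.dist_self⟩)

theorem sumCost_univ {V : Type*} [Fintype V] [DecidableEq V] (G : SimpleGraph V) (α : ℝ) (v : V) :
    sumCost G α univ v = α := by
  simp [sumCost, comDist, gwDist_eq_zero]

/-- If `α ≤ n - 1`, every node pays at least `α` in every nonempty profile. -/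
theorem le_sumCost {V : Type*} [Fintype V] [DecidableEq V] {G : SimpleGraph V}
    (hG : G.Connected) {α : ℝ} (h : α ≤ (Fintype.card V : ℝ) - 1) {S : Finset V}
    (hS : S.Nonempty) (v : V) : α ≤ sumCost G α S v := by
  unfold sumCost
  split_ifs with hv
  · exact le_add_of_nonneg_right (by positivity)
  · have hcard : ∑ u : V, (if u = v then (0 : ℝ) else 1) = (Fintype.card V : ℝ) - 1 := by
      have hsplit : ∀ u : V, (if u = v then (0 : ℝ) else 1) = 1 - if u = v then 1 else 0 := by
        intro u
        split_ifs <;> norm_num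
      simp [hsplit, Finset.sum_sub_distrib]
    rw [zero_add]
    refine (h.trans hcard.ge).trans (Finset.sum_le_sum fun u _ => ?_)
    split_ifs with hu
    · positivity
    · have hcom : 1 ≤ comDist G S v u :=
        le_min (hG.pos_dist_of_ne (Ne.symm hu)) ((one_le_gwDist hG hS hv).trans le_self_add)
      exact_mod_cast hcom

/-- If α ≤ n−1, the price of stability of the SUM-game is 1: some Nash equilibrium
minimizes the social cost among all nonempty profiles. -/
theorem stmt_3 {V : Type*} [Fintype V] [DecidableEq V] (G : SimpleGraph V)
    (hG : G.Connected) (α : ℝ) (hα : 0 < α)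
    (h : α ≤ (Fintype.card V : ℝ) - 1) :
    ∃ S : Finset V, S.Nonempty ∧ SumNash G α S ∧
      ∀ S' : Finset V, S'.Nonempty → sumSocial G α S ≤ sumSocial G α S' := by
  have := hG.nonempty
  refine ⟨univ, univ_nonempty, ?_, fun S' hS' => Finset.sum_le_sum fun v _ => ?_⟩
  · rintro S' ⟨v, hmove, hlt⟩
    rcases hmove with ⟨hv, -⟩ | ⟨-, rfl, hne⟩
    · exact hv (mem_univ v)
    · rw [sumCost_univ] at hlt
      exact hlt.not_ge (le_sumCost hG h hne v)
  · rw [sumCost_univ]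
    exact le_sumCost hG h hS' v
end

section
/- Let S ⊆ V be a nonempty initial set of gateways and let C_1, …, C_k be the connected components of the subgraph of G induced on V∖S. If n − max_{i=1,…,k} |C_i| ≥ α, then every sequence of improving responses in the SUM-game starting from S in which only nodes of V∖S change their strategies is finite. -/
open Finset

theorem gwDist_le_dist {V : Type*} (G : SimpleGraph V) {S : Finset V} {s : V} (hs : s ∈ S)
    (u : V) : gwDist G S u ≤ G.dist u s :=
  Nat.sInf_le ⟨s, hs, rfl⟩

theorem exists_dist_eq_gwDist {V : Type*} (G : SimpleGraph V) {S : Finset V}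
    (hS : S.Nonempty) (u : V) : ∃ s ∈ S, G.dist u s = gwDist G S u :=
  Nat.sInf_mem (s := (fun s => G.dist u s) '' (S : Set V)) (hS.to_set.image _)

theorem gwDist_anti {V : Type*} (G : SimpleGraph V) {S T : Finset V} (hS : S.Nonempty)
    (hST : S ⊆ T) (u : V) : gwDist G T u ≤ gwDist G S u := by
  obtain ⟨s, hs, h⟩ := exists_dist_eq_gwDist G hS u
  exact h ▸ gwDist_le_dist G (hST hs) u

theorem gwDist_eq_zero_of_mem {V : Type*} (G : SimpleGraph V) {S : Finset V} {u : V}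
    (hu : u ∈ S) : gwDist G S u = 0 := by
  simpa using gwDist_le_dist G hu u

theorem gwDist_pos_of_notMem {V : Type*} {G : SimpleGraph V} (hG : G.Connected)
    {S : Finset V} (hS : S.Nonempty) {u : V} (hu : u ∉ S) : 0 < gwDist G S u := by
  obtain ⟨s, hs, h⟩ := exists_dist_eq_gwDist G hS u
  exact h ▸ hG.pos_dist_of_ne (ne_of_mem_of_not_mem hs hu).symm

theorem comDist_anti {V : Type*} (G : SimpleGraph V) {S T : Finset V} (hS : S.Nonempty)
    (hST : S ⊆ T) (u v : V) : comDist G T u v ≤ comDist G S u v :=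
  min_le_min le_rfl (add_le_add (gwDist_anti G hS hST u) (gwDist_anti G hS hST v))

/-- Nodes that are separated by the gateways communicate through a gateway. -/
theorem gwDist_add_gwDist_le_dist {V : Type*} {G : SimpleGraph V} (hG : G.Connected)
    {S : Finset V} {u v : V} (hv : v ∉ S)
    (huv : ¬ ∃ hu : u ∉ S, (G.induce {x : V | x ∉ S}).Reachable ⟨u, hu⟩ ⟨v, hv⟩) :
    gwDist G S u + gwDist G S v ≤ G.dist u v := by
  classical
  obtain ⟨p, hp⟩ := hG.exists_walk_length_eq_dist u v
  obtain ⟨s, hsp, hs⟩ : ∃ s ∈ p.support, s ∈ S := by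
    by_contra! h
    exact huv ⟨h u p.start_mem_support, ⟨p.induce {x : V | x ∉ S} h⟩⟩
  have hlen := congrArg SimpleGraph.Walk.length (p.take_spec hsp)
  rw [SimpleGraph.Walk.length_append] at hlen
  have h₁ := SimpleGraph.dist_le (p.takeUntil s hsp)
  have h₂ := SimpleGraph.dist_le (p.dropUntil s hsp)
  have h₃ := gwDist_le_dist G hs u
  have h₄ := gwDist_le_dist G hs v
  rw [SimpleGraph.dist_comm] at h₄
  omega

/-- Opening `v` strictly shortens its distance to every node separated from it by `S`. -/
theorem comDist_insert_lt {V : Type*} [DecidableEq V] {G : SimpleGraph V} (hG : G.Connected)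
    {S R : Finset V} (hS : S.Nonempty) (hSR : S ⊆ R) {u v : V} (hv : v ∉ S) (hvR : v ∉ R)
    (huv : ¬ ∃ hu : u ∉ S, (G.induce {x : V | x ∉ S}).Reachable ⟨u, hu⟩ ⟨v, hv⟩) :
    comDist G (insert v R) v u < comDist G R v u := by
  have hR : R.Nonempty := hS.mono hSR
  have h₁ := gwDist_add_gwDist_le_dist hG hv huv
  rw [SimpleGraph.dist_comm] at h₁
  have h₂ := gwDist_anti G hS hSR u
  have h₃ := gwDist_anti G hS hSR v
  have h₄ := gwDist_pos_of_notMem hG hR hvR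
  have h₅ := gwDist_anti G hR (subset_insert v R) u
  have h₆ := gwDist_eq_zero_of_mem G (mem_insert_self v R)
  unfold comDist
  omega

theorem sumCost_insert_le {V : Type*} [Fintype V] [DecidableEq V] {G : SimpleGraph V}
    (hG : G.Connected) {α : ℝ} {S R : Finset V} (hS : S.Nonempty) (hSR : S ⊆ R)
    {v : V} (hv : v ∉ S) (hvR : v ∉ R)
    (hα : α ≤ (Fintype.card V : ℝ) -
        ({u : V | ∃ hu : u ∉ S,
            (G.induce {x : V | x ∉ S}).Reachable ⟨u, hu⟩ ⟨v, hv⟩}.ncard : ℝ)) :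
    sumCost G α (insert v R) v ≤ sumCost G α R v := by
  classical
  set C : Set V := {u : V | ∃ hu : u ∉ S,
    (G.induce {x : V | x ∉ S}).Reachable ⟨u, hu⟩ ⟨v, hv⟩} with hC
  have hsum : ∑ u : V, (comDist G (insert v R) v u + (1 - if u ∈ C then 1 else 0) : ℝ) ≤
      ∑ u : V, (comDist G R v u : ℝ) := by
    refine sum_le_sum fun u _ => ?_
    split_ifs with hu
    · simpa using comDist_anti G (hS.mono hSR) (subset_insert v R) v u
    · rw [sub_zero]
      exact_mod_cast comDist_insert_lt hG hS hSR hv hvR hu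
  have hcard : ∑ u : V, (if u ∈ C then 1 else 0 : ℝ) = C.ncard := by
    rw [sum_boole, Set.ncard_eq_toFinset_card']
    congr 2
    ext u
    simp
  rw [sum_add_distrib, sum_sub_distrib, hcard] at hsum
  simp only [sum_const, card_univ, nsmul_eq_mul, mul_one] at hsum
  simp only [sumCost, mem_insert_self, if_true, hvR, if_false]
  linarith

/-- If every connected component C of the subgraph induced on V∖S satisfies n − |C| ≥ α,
then every improving-response sequence starting from S in which only nodes of V∖S move
is finite. -/
theorem stmt_5 {V : Type*} [Fintype V] [DecidableEq V] (G : SimpleGraph V)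
    (hG : G.Connected) (α : ℝ) (hα : 0 < α)
    (S : Finset V) (hS : S.Nonempty)
    (hcomp : ∀ (v : V) (hv : v ∉ S),
      α ≤ (Fintype.card V : ℝ) -
        ({u : V | ∃ hu : u ∉ S,
            (G.induce {x : V | x ∉ S}).Reachable ⟨u, hu⟩ ⟨v, hv⟩}.ncard : ℝ)) :
    ¬ ∃ seq : ℕ → Finset V, seq 0 = S ∧
        ∀ i, ∃ v, v ∉ S ∧ SumIRBy G α v (seq i) (seq (i + 1)) := by
  rintro ⟨seq, h0, hstep⟩
  have hinv : ∀ i, S ⊆ seq i ∧ i ≤ (seq i).card := by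
    intro i
    induction i with
    | zero => exact ⟨h0.ge, Nat.zero_le _⟩
    | succ i ih =>
      obtain ⟨hsub, hcard⟩ := ih
      obtain ⟨v, hv, ⟨hvi, heq⟩ | ⟨hvi, heq, -⟩, hlt⟩ := hstep i
      · rw [heq, card_insert_of_notMem hvi]
        exact ⟨hsub.trans (subset_insert v _), Nat.succ_le_succ hcard⟩
      · have hle := sumCost_insert_le hG hS (subset_erase.2 ⟨hsub, hv⟩) hv
          (notMem_erase v (seq i)) (hcomp v hv)
        rw [insert_erase hvi, ← heq] at hle
        exact absurd hlt hle.not_gt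
  have h := (hinv (Fintype.card V + 1)).2.trans (card_le_univ _)
  omega
end

section
/- For every integer n and real α with 4 ≤ α ≤ n−1, there exist a finite connected simple graph G on n vertices and a profile S with |S| = 1 such that S is a Nash equilibrium of the SUM-game and c(S) ≥ (n/2)·⌊(n−1)/(⌊√α⌋−1)⌋·(⌊√α⌋−1)·⌊√α⌋, while c(V) = αn; consequently the price of anarchy in this range is Ω(n/√α). -/
open Finset

/-- Distance to the centre of the `i`-th node of a spider whose legs have length `L`; node `0` is
the centre, and the legs are filled one after the other, from the inside out. -/
def legHeight (L i : ℕ) : ℕ := if i = 0 then 0 else (i - 1) % L + 1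

/-- Index of the leg containing the `i`-th node of the spider. -/
def legIndex (L i : ℕ) : ℕ := (i - 1) / L

/-- The spider on `n` nodes with legs of length `L`, the last leg possibly being shorter. -/
def spider (n L : ℕ) : SimpleGraph (Fin n) where
  Adj u v :=
    (legHeight L v = legHeight L u + 1 ∧ (legHeight L u = 0 ∨ legIndex L u = legIndex L v)) ∨
    (legHeight L u = legHeight L v + 1 ∧ (legHeight L v = 0 ∨ legIndex L v = legIndex L u))
  symm := ⟨fun _ _ h => h.symm⟩
  loopless := ⟨fun _ h => by omega⟩

/-- Height in the spider, counted negatively on the leg `a`. -/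
def signedHeight (L a i : ℕ) : ℤ :=
  if legIndex L i = a then -(legHeight L i : ℤ) else legHeight L i

lemma abs_sub_le_dist {V : Type*} {G : SimpleGraph V} (hG : G.Connected) {f : V → ℤ}
    (hf : ∀ u v, G.Adj u v → |f u - f v| ≤ 1) (u v : V) : |f u - f v| ≤ G.dist u v := by
  obtain ⟨p, hp⟩ := hG.exists_walk_length_eq_dist u v
  rw [← hp]
  clear hp
  induction p with
  | nil => simp
  | @cons a b c hab p ih =>
    have := abs_sub_le (f a) (f b) (f c)
    have := hf _ _ hab
    rw [SimpleGraph.Walk.length_cons]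
    push_cast
    linarith

lemma abs_signedHeight_sub_le_one {n L : ℕ} (a : ℕ) {u v : Fin n} (h : (spider n L).Adj u v) :
    |signedHeight L a u - signedHeight L a v| ≤ 1 := by
  simp only [spider] at h
  unfold signedHeight
  rw [abs_le]
  rcases h with ⟨h, h' | h'⟩ | ⟨h, h' | h'⟩ <;> split_ifs <;> omega

lemma exists_walk_to_centre {n L : ℕ} (hn : 0 < n) (u : Fin n) :
    ∃ p : (spider n L).Walk u ⟨0, hn⟩, p.length = legHeight L u := by
  obtain ⟨i, hi⟩ := u
  induction i using Nat.strong_induction_on with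
  | _ i ih =>
    rcases Nat.eq_zero_or_pos i with rfl | hpos
    · exact ⟨.nil, by simp [legHeight]⟩
    · by_cases hm : (i - 1) % L = 0
      · have hadj : (spider n L).Adj ⟨i, hi⟩ ⟨0, hn⟩ := by
          right
          simp [legHeight, hpos.ne', hm]
        exact ⟨hadj.toWalk, by simp [legHeight, hpos.ne', hm]⟩
      · obtain ⟨p, hp⟩ := ih (i - 1) (by omega) (by omega)
        have h1 : i - 1 ≠ 0 := by
          rintro h
          simp [h] at hm
        obtain ⟨j, rfl⟩ : ∃ j, i = j + 2 := ⟨i - 2, by omega⟩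
        have hdm : ¬ L ∣ j + 1 := fun hd => hm (Nat.mod_eq_zero_of_dvd hd)
        have hdiv : (j + 1) / L = j / L := Nat.succ_div_of_not_dvd hdm
        have hmod : (j + 1) % L = j % L + 1 := by
          have e1 := Nat.div_add_mod (j + 1) L
          have e2 := Nat.div_add_mod j L
          rw [hdiv] at e1
          omega
        have hh : legHeight L (j + 2) = legHeight L (j + 2 - 1) + 1 := by
          simp [legHeight, hmod]
        have hadj : (spider n L).Adj ⟨j + 2, hi⟩ ⟨j + 2 - 1, by omega⟩ :=
          Or.inr ⟨hh, Or.inr (by simp [legIndex, hdiv])⟩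
        exact ⟨.cons hadj p, by rw [SimpleGraph.Walk.length_cons, hp, hh]⟩

lemma spider_connected {n : ℕ} (L : ℕ) (hn : 0 < n) : (spider n L).Connected := by
  have : Nonempty (Fin n) := ⟨⟨0, hn⟩⟩
  refine ⟨fun u v => ?_⟩
  obtain ⟨p, -⟩ := exists_walk_to_centre (L := L) hn u
  obtain ⟨q, -⟩ := exists_walk_to_centre (L := L) hn v
  exact ⟨p.append q.reverse⟩

lemma spider_dist_le {n L : ℕ} (u v : Fin n) :
    (spider n L).dist u v ≤ legHeight L u + legHeight L v := by
  obtain ⟨p, hp⟩ := exists_walk_to_centre (L := L) u.pos u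
  obtain ⟨q, hq⟩ := exists_walk_to_centre (L := L) u.pos v
  have := SimpleGraph.dist_le (p.append q.reverse)
  simpa [hp, hq] using this

lemma abs_signedHeight_sub_le_dist {n L : ℕ} (a : ℕ) (u v : Fin n) :
    |signedHeight L a u - signedHeight L a v| ≤ (spider n L).dist u v :=
  abs_sub_le_dist (f := fun w : Fin n => signedHeight L a w) (spider_connected L u.pos)
    (fun _ _ h => abs_signedHeight_sub_le_one a h) u v

lemma card_legIndex_eq_le {n L : ℕ} (hL : 0 < L) (a : ℕ) :
    #{v : Fin n | legIndex L v = a} ≤ L + 1 := by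
  calc #{v : Fin n | legIndex L v = a}
      ≤ #(insert 0 (Ico (a * L + 1) (a * L + 1 + L))) := by
        refine card_le_card_of_injOn (fun v => v.val) ?_ Fin.val_injective.injOn
        intro v hv
        have hdiv : (v.val - 1) / L = a := (mem_filter.mp (mem_coe.mp hv)).2
        have hdm := Nat.div_add_mod' (v.val - 1) L
        have hlt := Nat.mod_lt (v.val - 1) hL
        rw [hdiv] at hdm
        simp only [coe_insert, coe_Ico, Set.mem_insert_iff, Set.mem_Ico]
        omega
    _ ≤ _ := card_insert_le _ _
    _ = L + 1 := by simp

lemma sum_legHeight_le_sum_dist {n L : ℕ} (hL : 0 < L) (hn : 2 * (L + 1) ≤ n) (u : Fin n) :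
    ∑ v : Fin n, legHeight L v ≤ ∑ v : Fin n, (spider n L).dist u v := by
  have hpt : ∀ v : Fin n, (legHeight L v : ℤ) + legHeight L u ≤ (spider n L).dist u v
      + 2 * legHeight L u * (if legIndex L v = legIndex L u then 1 else 0) := by
    intro v
    have := abs_le.mp (abs_signedHeight_sub_le_dist (L := L) (legIndex L u) u v)
    unfold signedHeight at this
    split_ifs at this ⊢ <;> omega
  have hsum := sum_le_sum fun v (_ : v ∈ univ) => hpt v
  rw [sum_add_distrib, sum_add_distrib, ← mul_sum, sum_boole] at hsum
  have hcard := card_legIndex_eq_le (n := n) hL (legIndex L u)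
  have hcard' : ((2 * #{v : Fin n | legIndex L v = legIndex L u} : ℕ) : ℤ) ≤ n := by
    exact_mod_cast (by omega)
  have h0 : (0 : ℤ) ≤ legHeight L u := by positivity
  simp only [sum_const, card_univ, Fintype.card_fin, nsmul_eq_mul] at hsum
  zify
  push_cast at hcard'
  nlinarith

lemma sum_range_mod_add_one (q : ℕ) {L : ℕ} :
    (∑ i ∈ range (q * L), (i % L + 1)) * 2 = q * L * (L + 1) := by
  induction q with
  | zero => simp
  | succ q ih =>
    have : ∑ x ∈ range L, ((q * L + x) % L + 1) = ∑ x ∈ range L, (x + 1) :=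
      sum_congr rfl fun x hx => by
        rw [Nat.mul_add_mod_self_right, Nat.mod_eq_of_lt (mem_range.mp hx)]
    have h2 := sum_range_id_mul_two (L + 1)
    rw [sum_range_succ'] at h2
    simp only [add_tsub_cancel_right, add_zero] at h2
    rw [Nat.succ_mul, sum_range_add, add_mul, ih, this, h2]
    ring

lemma le_two_mul_sum_legHeight {n L : ℕ} :
    (n - 1) / L * L * (L + 1) ≤ (∑ v : Fin n, legHeight L v) * 2 := by
  rcases n with _ | m
  · simp
  rw [Fin.sum_univ_eq_sum_range (fun i => legHeight L i), sum_range_succ']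
  simp only [legHeight, Nat.add_sub_cancel, Nat.add_eq_zero_iff, one_ne_zero, and_false,
    if_false, if_true, add_zero]
  rw [← sum_range_mod_add_one]
  gcongr
  exact Nat.div_mul_le_self m L

lemma spider_dist_le_min_add {n L : ℕ} (hL : 0 < L) (hn : L < n) (u v : Fin n) :
    (spider n L).dist v u ≤ min ((spider n L).dist v u) ((spider n L).dist u ⟨L, hn⟩)
      + if u.val ≤ L then 2 * u.val else 0 := by
  have hs : legIndex L L = 0 := Nat.div_eq_of_lt (by omega)
  have hsh : legHeight L L = L := by
    rw [legHeight, if_neg hL.ne', Nat.mod_eq_of_lt (by omega)]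
    omega
  have hlow := abs_le.mp (abs_signedHeight_sub_le_dist (L := L) 0 u ⟨L, hn⟩)
  have hup := spider_dist_le (L := L) v u
  have hv : legHeight L v ≤ L := by
    unfold legHeight
    have := Nat.mod_lt (v.val - 1) hL
    split_ifs <;> omega
  have hu : legHeight L u ≤ u := by
    unfold legHeight
    have := Nat.mod_le (u.val - 1) L
    split_ifs <;> omega
  have hleg : legIndex L u = 0 → u.val ≤ L := fun h => by
    have := (Nat.div_eq_zero_iff_lt hL).mp h
    omega
  simp only [signedHeight, hs, hsh, if_true] at hlow
  by_cases h0 : legIndex L u = 0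
  · rw [if_pos h0] at hlow
    rw [if_pos (hleg h0)]
    omega
  · rw [if_neg h0] at hlow
    omega

lemma sum_two_mul_initial_le {n L : ℕ} :
    ∑ u : Fin n, (if u.val ≤ L then 2 * u.val else 0) ≤ L * (L + 1) := by
  rw [Fin.sum_univ_eq_sum_range (fun i => if i ≤ L then 2 * i else 0), ← sum_filter]
  calc _ ≤ ∑ i ∈ range (L + 1), 2 * i :=
        sum_le_sum_of_subset fun i hi => by
          simp only [mem_filter, mem_range] at hi ⊢
          omega
    _ = L * (L + 1) := by
        rw [← mul_sum, mul_comm, sum_range_id_mul_two, mul_comm, Nat.add_sub_cancel]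

lemma gwDist_singleton {V : Type*} (G : SimpleGraph V) (s u : V) :
    gwDist G {s} u = G.dist u s := by
  simp [gwDist]

lemma exists_gwDist_eq {V : Type*} (G : SimpleGraph V) {S : Finset V} (hS : S.Nonempty) (u : V) :
    ∃ s ∈ S, gwDist G S u = G.dist u s := by
  obtain ⟨s, hs, h⟩ := Nat.sInf_mem (s := (fun s => G.dist u s) '' (S : Set V)) (by simpa using hS)
  exact ⟨s, hs, h.symm⟩

lemma comDist_singleton {V : Type*} {G : SimpleGraph V} (hG : G.Connected) (s u v : V) :
    comDist G {s} u v = G.dist u v := by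
  rw [comDist, gwDist_singleton, gwDist_singleton, G.dist_comm (u := v)]
  exact min_eq_left hG.dist_triangle

lemma min_dist_le_comDist_pair {V : Type*} [DecidableEq V] (G : SimpleGraph V) (s u v : V) :
    min (G.dist v u) (G.dist u s) ≤ comDist G {v, s} v u := by
  obtain ⟨t, ht, h⟩ := exists_gwDist_eq G (S := {v, s}) (by simp) u
  have := G.dist_comm (u := v) (v := u)
  simp only [mem_insert, mem_singleton] at ht
  unfold comDist
  rcases ht with rfl | rfl <;> omega

lemma comDist_univ {V : Type*} [Fintype V] (G : SimpleGraph V) (u v : V) :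
    comDist G univ u v = 0 := by
  have h : ∀ w, gwDist G univ w = 0 := fun w =>
    Nat.sInf_eq_zero.mpr (Or.inl ⟨w, by simp, by simp⟩)
  simp [comDist, h]

lemma sumSocial_univ {V : Type*} [Fintype V] [DecidableEq V] (G : SimpleGraph V) (α : ℝ) :
    sumSocial G α univ = α * Fintype.card V := by
  simp [sumSocial, sumCost, comDist_univ, mul_comm]

lemma sumNash_singleton {V : Type*} [Fintype V] [DecidableEq V] {G : SimpleGraph V} {α : ℝ}
    {s : V} (h : ∀ v, v ≠ s → sumCost G α {s} v ≤ sumCost G α {v, s} v) : SumNash G α {s} := by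
  rintro S' ⟨v, ⟨hv, rfl⟩ | ⟨hv, -, hne⟩, hlt⟩
  · exact (h v (by simpa using hv)).not_gt hlt
  · obtain rfl := mem_singleton.mp hv
    simp at hne

lemma sumNash_spider {n L : ℕ} {α : ℝ} (hL : 0 < L) (hn : L < n) (hα : (L : ℝ) * (L + 1) ≤ α) :
    SumNash (spider n L) α {⟨L, hn⟩} := by
  refine sumNash_singleton fun v hv => ?_
  have hpt : ∀ u : Fin n, comDist (spider n L) {⟨L, hn⟩} v u ≤
      comDist (spider n L) {v, ⟨L, hn⟩} v u + if u.val ≤ L then 2 * u.val else 0 := fun u =>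
    (min_le_left _ _).trans ((spider_dist_le_min_add hL hn u v).trans
      (Nat.add_le_add_right (min_dist_le_comDist_pair _ _ _ _) _))
  have hsum := sum_le_sum fun u (_ : u ∈ univ) => hpt u
  rw [sum_add_distrib] at hsum
  have hsum' := hsum.trans (Nat.add_le_add_left sum_two_mul_initial_le _)
  have hreal : (∑ u, (comDist (spider n L) {⟨L, hn⟩} v u : ℝ)) ≤
      ∑ u, (comDist (spider n L) {v, ⟨L, hn⟩} v u : ℝ) + L * (L + 1) := by
    exact_mod_cast hsum'
  simp only [sumCost, mem_singleton, hv, if_false, mem_insert_self, if_true]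
  linarith

lemma le_sumSocial_spider {n L : ℕ} {α : ℝ} (hα : 0 ≤ α) (hL : 0 < L) (hn : 2 * (L + 1) ≤ n)
    (s : Fin n) :
    (n : ℝ) / 2 * ((n - 1) / L : ℕ) * L * (L + 1) ≤ sumSocial (spider n L) α {s} := by
  have hrow : ∀ v : Fin n, (((n - 1) / L : ℕ) : ℝ) * L * (L + 1) / 2 ≤
      sumCost (spider n L) α {s} v := by
    intro v
    have h := (le_two_mul_sum_legHeight (n := n) (L := L)).trans
      (Nat.mul_le_mul_right 2 (sum_legHeight_le_sum_dist hL hn v))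
    have h' : (((n - 1) / L : ℕ) : ℝ) * L * (L + 1) ≤
        (∑ u, ((spider n L).dist v u : ℝ)) * 2 := by exact_mod_cast h
    simp only [sumCost, comDist_singleton (spider_connected L v.pos)]
    have : 0 ≤ if v ∈ ({s} : Finset (Fin n)) then α else 0 := by split_ifs <;> simp [hα]
    linarith
  have := sum_le_sum fun v (_ : v ∈ univ) => hrow v
  simp only [sum_const, card_univ, Fintype.card_fin, nsmul_eq_mul] at this
  rw [sumSocial]
  linarith

/-- For 4 ≤ α ≤ n−1 there are a connected graph on n vertices and a singleton Nash
equilibrium S of the SUM-game with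
c(S) ≥ (n/2)·⌊(n−1)/(⌊√α⌋−1)⌋·(⌊√α⌋−1)·⌊√α⌋, while c(V) = αn;
hence the price of anarchy in this range is Ω(n/√α). -/
theorem stmt_12 (n : ℕ) (α : ℝ) (h4 : 4 ≤ α) (hαn : α ≤ (n : ℝ) - 1) :
    ∃ (G : SimpleGraph (Fin n)) (S : Finset (Fin n)), G.Connected ∧ S.card = 1 ∧
      SumNash G α S ∧
      ((n : ℝ) / 2) * (((n - 1) / (Nat.floor (Real.sqrt α) - 1) : ℕ) : ℝ) *
          ((Nat.floor (Real.sqrt α) : ℝ) - 1) * (Nat.floor (Real.sqrt α) : ℝ)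
        ≤ sumSocial G α S ∧
      sumSocial G α Finset.univ = α * (n : ℝ) := by
  have hα : 0 ≤ α := by linarith
  have hk2 : 2 ≤ ⌊√α⌋₊ := by
    rw [Nat.le_floor_iff (Real.sqrt_nonneg _)]
    exact Real.le_sqrt_of_sq_le (by norm_num; linarith)
  have hkα : (⌊√α⌋₊ : ℝ) ^ 2 ≤ α :=
    (Real.le_sqrt (by positivity) hα).mp (Nat.floor_le (Real.sqrt_nonneg _))
  generalize ⌊√α⌋₊ = k at *
  obtain ⟨L, rfl⟩ : ∃ L, k = L + 1 := ⟨k - 1, by omega⟩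
  have hL : 0 < L := by omega
  have hkn : (L + 1) ^ 2 + 1 ≤ n := by
    have : (((L + 1 : ℕ) : ℝ)) ^ 2 + 1 ≤ n := by linarith
    exact_mod_cast this
  have hn2 : 2 * (L + 1) ≤ n := by nlinarith
  have hLn : L < n := by omega
  refine ⟨spider n L, {⟨L, hLn⟩}, spider_connected L (by omega), card_singleton _,
    sumNash_spider hL hLn ?_, ?_, by simp [sumSocial_univ]⟩
  · push_cast at hkα
    nlinarith
  · have := le_sumSocial_spider hα hL hn2 ⟨L, hLn⟩
    simpa using this
end
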